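/- With coordinates (a₁,a₂,a₃,a₄,α₁,α₂,α₃,β₁,β₂,γ) on ℝ¹⁰, define the five polynomial functions Ĩ₁ = γα₂ − 2β₁β₂, Ĩ₂ = γ(α₁ + α₃) + β₂² − β₁², Ĩ₃ = γ²(a₁ − 3a₃) + 3γ(β₂α₂ − β₁(α₁ + α₃)) + 2β₁(β₁² − 3β₂²), Ĩ₄ = γ²(3a₂ − a₄) − 3γ(β₁α₂ + β₂(α₁ + α₃)) + 2β₂(3β₁² − β₂²), Ĩ₅ = γ. Then each Ĩ_k (k = 1,…,5) is annihilated at every point of ℝ¹⁰ by each of the five vector fields V₁, V₂, T₁, T₂, T₃; that is, the directional derivative of Ĩ_k along each of these vector fields vanishes identically. -/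

import Mathlib

/- STATEMENT 9: The five polynomials Ĩ₁,…,Ĩ₅ on the parameter space ℝ¹⁰ are annihilated
by each of the vector fields V₁, V₂, T₁, T₂, T₃ (directional derivative vanishes
identically). -/

noncomputable section

/- Coordinates on ℝ¹⁰ = Fin 10 → ℝ:
0:a₁, 1:a₂, 2:a₃, 3:a₄, 4:α₁, 5:α₂, 6:α₃, 7:β₁, 8:β₂, 9:γ. -/

def V₁ : (Fin 10 → ℝ) → (Fin 10 → ℝ) :=
  fun x => ![0, -x 4, -x 5, 3 * x 6, 0, -2 * x 7, 2 * x 8, 0, -x 9, 0]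

def V₂ : (Fin 10 → ℝ) → (Fin 10 → ℝ) :=
  fun x => ![3 * x 4, x 5, -x 6, 0, 2 * x 7, 2 * x 8, 0, x 9, 0, 0]

def T₁ : (Fin 10 → ℝ) → (Fin 10 → ℝ) :=
  fun _ => ![3, 0, 1, 0, 0, 0, 0, 0, 0, 0]

def T₂ : (Fin 10 → ℝ) → (Fin 10 → ℝ) :=
  fun _ => ![0, 1, 0, 3, 0, 0, 0, 0, 0, 0]

def T₃ : (Fin 10 → ℝ) → (Fin 10 → ℝ) :=
  fun _ => ![0, 0, 0, 0, 1, 0, -1, 0, 0, 0]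

/-- Ĩ₁ = γα₂ − 2β₁β₂ -/
def It₁ : (Fin 10 → ℝ) → ℝ := fun x => x 9 * x 5 - 2 * x 7 * x 8

/-- Ĩ₂ = γ(α₁ + α₃) + β₂² − β₁² -/
def It₂ : (Fin 10 → ℝ) → ℝ := fun x => x 9 * (x 4 + x 6) + x 8 ^ 2 - x 7 ^ 2

/-- Ĩ₃ = γ²(a₁ − 3a₃) + 3γ(β₂α₂ − β₁(α₁ + α₃)) + 2β₁(β₁² − 3β₂²) -/
def It₃ : (Fin 10 → ℝ) → ℝ := fun x =>
  x 9 ^ 2 * (x 0 - 3 * x 2) + 3 * x 9 * (x 8 * x 5 - x 7 * (x 4 + x 6)) +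
  2 * x 7 * (x 7 ^ 2 - 3 * x 8 ^ 2)

/-- Ĩ₄ = γ²(3a₂ − a₄) − 3γ(β₁α₂ + β₂(α₁ + α₃)) + 2β₂(3β₁² − β₂²) -/
def It₄ : (Fin 10 → ℝ) → ℝ := fun x =>
  x 9 ^ 2 * (3 * x 1 - x 3) - 3 * x 9 * (x 7 * x 5 + x 8 * (x 4 + x 6)) +
  2 * x 8 * (3 * x 7 ^ 2 - x 8 ^ 2)

/-- Ĩ₅ = γ -/
def It₅ : (Fin 10 → ℝ) → ℝ := fun x => x 9

theorem fderiv_It₁_apply (x v : Fin 10 → ℝ) :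
    fderiv ℝ It₁ x v = v 9 * x 5 + x 9 * v 5 - 2 * (v 7 * x 8 + x 7 * v 8) := by
  have h := fun i : Fin 10 => hasFDerivAt_apply (𝕜 := ℝ) i x
  have hI : HasFDerivAt It₁ _ x :=
    ((h 9).mul (h 5)).sub (((h 7).const_mul 2).mul (h 8))
  rw [hI.fderiv]
  simp
  ring

theorem fderiv_It₂_apply (x v : Fin 10 → ℝ) :
    fderiv ℝ It₂ x v = v 9 * (x 4 + x 6) + x 9 * (v 4 + v 6)
      + 2 * x 8 * v 8 - 2 * x 7 * v 7 := by
  have h := fun i : Fin 10 => hasFDerivAt_apply (𝕜 := ℝ) i x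
  have hI : HasFDerivAt It₂ _ x :=
    (((h 9).mul ((h 4).add (h 6))).add ((h 8).pow 2)).sub ((h 7).pow 2)
  rw [hI.fderiv]
  simp
  ring

theorem fderiv_It₃_apply (x v : Fin 10 → ℝ) :
    fderiv ℝ It₃ x v = 2 * x 9 * v 9 * (x 0 - 3 * x 2) + x 9 ^ 2 * (v 0 - 3 * v 2)
      + 3 * v 9 * (x 8 * x 5 - x 7 * (x 4 + x 6))
      + 3 * x 9 * (v 8 * x 5 + x 8 * v 5 - v 7 * (x 4 + x 6) - x 7 * (v 4 + v 6))
      + 6 * (x 7 ^ 2 - x 8 ^ 2) * v 7 - 12 * x 7 * x 8 * v 8 := by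
  have h := fun i : Fin 10 => hasFDerivAt_apply (𝕜 := ℝ) i x
  have hI : HasFDerivAt It₃ _ x :=
    ((((h 9).pow 2).mul ((h 0).sub ((h 2).const_mul 3))).add
    (((h 9).const_mul 3).mul (((h 8).mul (h 5)).sub ((h 7).mul ((h 4).add (h 6)))))).add
    (((h 7).const_mul 2).mul (((h 7).pow 2).sub (((h 8).pow 2).const_mul 3)))
  rw [hI.fderiv]
  simp
  ring

theorem fderiv_It₄_apply (x v : Fin 10 → ℝ) :
    fderiv ℝ It₄ x v = 2 * x 9 * v 9 * (3 * x 1 - x 3) + x 9 ^ 2 * (3 * v 1 - v 3)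
      - 3 * v 9 * (x 7 * x 5 + x 8 * (x 4 + x 6))
      - 3 * x 9 * (v 7 * x 5 + x 7 * v 5 + v 8 * (x 4 + x 6) + x 8 * (v 4 + v 6))
      + 6 * (x 7 ^ 2 - x 8 ^ 2) * v 8 + 12 * x 7 * x 8 * v 7 := by
  have h := fun i : Fin 10 => hasFDerivAt_apply (𝕜 := ℝ) i x
  have hI : HasFDerivAt It₄ _ x :=
    ((((h 9).pow 2).mul (((h 1).const_mul 3).sub (h 3))).sub
    (((h 9).const_mul 3).mul (((h 7).mul (h 5)).add ((h 8).mul ((h 4).add (h 6)))))).add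
    (((h 8).const_mul 2).mul ((((h 7).pow 2).const_mul 3).sub ((h 8).pow 2)))
  rw [hI.fderiv]
  simp
  ring

theorem fderiv_It₅_apply (x v : Fin 10 → ℝ) : fderiv ℝ It₅ x v = v 9 := by
  have hI : HasFDerivAt It₅ _ x :=
    hasFDerivAt_apply (𝕜 := ℝ) 9 x
  rw [hI.fderiv]
  rfl

theorem subsystem_invariants :
    ∀ x : Fin 10 → ℝ, ∀ F ∈ ({It₁, It₂, It₃, It₄, It₅} : Set ((Fin 10 → ℝ) → ℝ)),
      fderiv ℝ F x (V₁ x) = 0 ∧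
      fderiv ℝ F x (V₂ x) = 0 ∧
      fderiv ℝ F x (T₁ x) = 0 ∧
      fderiv ℝ F x (T₂ x) = 0 ∧
      fderiv ℝ F x (T₃ x) = 0 := by
  rintro x F (rfl | rfl | rfl | rfl | rfl) <;>
    refine ⟨?_, ?_, ?_, ?_, ?_⟩ <;>
    simp only [fderiv_It₁_apply, fderiv_It₂_apply, fderiv_It₃_apply, fderiv_It₄_apply,
      fderiv_It₅_apply] <;>
    simp [V₁, V₂, T₁, T₂, T₃] <;>
    ring
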